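/- Suppose χ is a primitive Dirichlet character modulo N_β and let c be a positive integer with gcd(c, N_β) = 1. Then G_{γ,n}(c; β, χ) = χ(c) · χ̄(−N_β(γ,β)) · G(χ) · ∑_{d mod c, gcd(d,c)=1} ∑_{r ∈ (ℤ^m)/(cℤ^m)} e((a_d·Q(r̃) − (γ,r̃) + d(Q(γ)+n))/c), where r̃ ∈ ℤ^m is a representative of r and a_d ∈ ℤ is any inverse of d modulo c (the right-hand side is independent of all such choices); χ̄ is the complex conjugate character. In particular, the dependence of G_{γ,n}(c; β, χ) on β is only through the factor χ̄(−N_β(γ,β)). -/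

import Mathlib

open Finset Matrix

namespace EisensteinWeil

variable {m : ℕ}

/-- The bilinear form `(x,y) = xᵀ S y` on `ℚ^m`. -/
def bil (S : Matrix (Fin m) (Fin m) ℤ) (x y : Fin m → ℚ) : ℚ :=
  x ⬝ᵥ (S.map (Int.cast : ℤ → ℚ)).mulVec y

/-- The quadratic form `Q(x) = (x,x)/2`. -/
def Qf (S : Matrix (Fin m) (Fin m) ℤ) (x : Fin m → ℚ) : ℚ := bil S x x / 2

/-- Membership in the dual lattice `L' = S⁻¹ℤ^m`: `x ∈ L'` iff `(x,r) ∈ ℤ` for all `r ∈ ℤ^m`. -/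
def memDual (S : Matrix (Fin m) (Fin m) ℤ) (γ : Fin m → ℚ) : Prop :=
  ∀ r : Fin m → ℤ, ∃ z : ℤ, bil S γ (fun i => (r i : ℚ)) = z

/-- `N` is the order of `γ + ℤ^m` in `L'/ℤ^m`, i.e. the smallest positive integer with
`N • γ ∈ ℤ^m`. -/
def isOrderOf (γ : Fin m → ℚ) (N : ℕ) : Prop :=
  0 < N ∧ (∀ i, ∃ z : ℤ, (N : ℚ) * γ i = z) ∧
    ∀ k : ℕ, 0 < k → (∀ i, ∃ z : ℤ, (k : ℚ) * γ i = z) → N ≤ k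

/-- The representation number `N_{γ,n}(a)`, counting `r ∈ (ℤ^m)/(aℤ^m)`
(represented by `r : Fin m → Fin a`) with `Q(r − γ) + n ≡ 0 (mod a)`. -/
noncomputable def repNum (S : Matrix (Fin m) (Fin m) ℤ) (γ : Fin m → ℚ) (n : ℚ) (a : ℕ) : ℕ :=
  Nat.card {r : Fin m → Fin a //
    ∃ t : ℤ, Qf S ((fun i => ((r i : ℕ) : ℚ)) - γ) + n = (a : ℚ) * t}

/-- `e(x) = e^{2πix}`. -/
noncomputable def eQ (x : ℚ) : ℂ := Complex.exp (2 * Real.pi * Complex.I * (x : ℂ))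

/-- A canonical choice of inverse of `d` modulo `c`. -/
def adInv (c d : ℕ) : ℕ := ((d : ZMod c)⁻¹).val

/-- The sum `G_{γ,n}(c; β, χ)`. -/
noncomputable def Gsum (S : Matrix (Fin m) (Fin m) ℤ) (γ : Fin m → ℚ) (n : ℚ)
    (β : Fin m → ℚ) (Nβ : ℕ) (χ : DirichletCharacter ℂ Nβ) (c : ℕ) : ℂ :=
  ∑ ν ∈ (range Nβ).filter (fun ν => Nat.Coprime ν Nβ), χ (ν : ZMod Nβ) *
    ∑ d ∈ (range c).filter (fun d => Nat.Coprime d c),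
      ∑ r ∈ Fintype.piFinset (fun _ : Fin m => range c),
        eQ (((adInv c d : ℚ) * Qf S (ν • β + fun i => (r i : ℚ))
            - bil S γ (ν • β + fun i => (r i : ℚ))
            + (d : ℚ) * (Qf S γ + n)) / c)

/-- The Gauss sum `G(χ) = ∑_{u mod N, gcd(u,N)=1} χ(u) e(u/N)`. -/
noncomputable def gaussS (N : ℕ) (χ : DirichletCharacter ℂ N) : ℂ :=
  ∑ u ∈ (range N).filter (fun u => Nat.Coprime u N), χ (u : ZMod N) * eQ (u / N)


section Forms

variable (S : Matrix (Fin m) (Fin m) ℤ)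

lemma bil_add_left (x y z : Fin m → ℚ) : bil S (x + y) z = bil S x z + bil S y z := by
  simp [bil, add_dotProduct]

lemma bil_add_right (x y z : Fin m → ℚ) : bil S x (y + z) = bil S x y + bil S x z := by
  simp [bil, mulVec_add, dotProduct_add]

lemma bil_smul_left (a : ℚ) (x y : Fin m → ℚ) : bil S (a • x) y = a * bil S x y := by
  simp [bil]

lemma bil_smul_right (a : ℚ) (x y : Fin m → ℚ) : bil S x (a • y) = a * bil S x y := by
  simp [bil, mulVec_smul]

variable {S}

lemma bil_comm (hS : S.IsSymm) (x y : Fin m → ℚ) : bil S x y = bil S y x := by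
  have hT : (S.map (Int.cast : ℤ → ℚ))ᵀ = S.map Int.cast := by
    rw [← transpose_map, hS.eq]
  rw [bil, bil, dotProduct_mulVec, dotProduct_comm, ← mulVec_transpose, hT]

lemma Qf_add (hS : S.IsSymm) (x y : Fin m → ℚ) :
    Qf S (x + y) = Qf S x + bil S x y + Qf S y := by
  simp only [Qf, bil_add_left, bil_add_right, bil_comm hS y x]
  ring

lemma Qf_smul (a : ℚ) (x : Fin m → ℚ) : Qf S (a • x) = a ^ 2 * Qf S x := by
  simp only [Qf, bil_smul_left, bil_smul_right]
  ring

lemma bil_intCast (x y : Fin m → ℤ) :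
    bil S (fun i => (x i : ℚ)) (fun i => (y i : ℚ)) = ((x ⬝ᵥ S.mulVec y : ℤ) : ℚ) := by
  simp [bil, dotProduct, mulVec]

lemma two_dvd_dotProduct_mulVec_self (hS : S.IsSymm) (hSeven : ∀ i, 2 ∣ S i i)
    (x : Fin m → ℤ) : 2 ∣ x ⬝ᵥ S.mulVec x := by
  refine (ZMod.intCast_zmod_eq_zero_iff_dvd _ 2).mp ?_
  have key : ∑ p : Fin m × Fin m, ((x p.1 * (S p.1 p.2 * x p.2) : ℤ) : ZMod 2) = 0 := by
    refine Finset.sum_involution (fun p _ => p.swap) ?_ ?_ (by simp) (by simp)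
    · rintro ⟨i, j⟩ -
      have h : S j i = S i j := hS.apply i j
      simp only [Prod.swap, h]
      rw [← Int.cast_add]
      refine (ZMod.intCast_zmod_eq_zero_iff_dvd _ 2).mpr ⟨x i * (S i j * x j), ?_⟩
      push_cast
      ring
    · rintro ⟨i, j⟩ - hne heq
      obtain rfl : j = i := congrArg Prod.fst heq
      refine hne ((ZMod.intCast_zmod_eq_zero_iff_dvd _ 2).mpr ?_)
      exact dvd_mul_of_dvd_right (dvd_mul_of_dvd_left (hSeven j) _) _
  rw [Fintype.sum_prod_type] at key
  rw [← key]
  simp [dotProduct, mulVec, Finset.mul_sum]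

lemma exists_Qf_intCast (hS : S.IsSymm) (hSeven : ∀ i, 2 ∣ S i i) (x : Fin m → ℤ) :
    ∃ z : ℤ, Qf S (fun i => (x i : ℚ)) = z := by
  obtain ⟨z, hz⟩ := two_dvd_dotProduct_mulVec_self hS hSeven x
  exact ⟨z, by rw [Qf, bil_intCast, hz]; push_cast; ring⟩

end Forms

lemma eQ_add (x y : ℚ) : eQ (x + y) = eQ x * eQ y := by
  rw [eQ, eQ, eQ, ← Complex.exp_add]
  push_cast
  ring_nf

lemma eQ_intCast (z : ℤ) : eQ z = 1 := by
  rw [eQ, Complex.exp_eq_one_iff]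
  exact ⟨z, by push_cast; ring⟩

lemma eQ_eq_of_sub_eq_intCast {x y : ℚ} (z : ℤ) (h : x - y = z) : eQ x = eQ y := by
  rw [show x = y + z by linarith, eQ_add, eQ_intCast, mul_one]

lemma eQ_intCast_div (N : ℕ) [NeZero N] (k : ℤ) :
    eQ ((k : ℚ) / N) = ZMod.stdAddChar (k : ZMod N) := by
  rw [ZMod.stdAddChar_coe, eQ]
  push_cast
  ring_nf

lemma sum_range_coprime_eq_sum_zmod (N : ℕ) [NeZero N] (χ : DirichletCharacter ℂ N)
    (f : ZMod N → ℂ) :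
    ∑ u ∈ (range N).filter (fun u => Nat.Coprime u N), χ (u : ZMod N) * f u =
      ∑ x : ZMod N, χ x * f x := by
  rw [Finset.sum_filter_of_ne]
  · refine Finset.sum_nbij' (fun u => (u : ZMod N)) ZMod.val (by simp)
      (fun x _ => by simpa using ZMod.val_lt x) ?_ (by simp) (by simp)
    intro u hu
    exact ZMod.val_cast_of_lt (by simpa using hu)
  · intro u _ hne
    by_contra hu
    refine hne ?_
    rw [χ.map_nonunit (by rwa [ZMod.isUnit_iff_coprime]), zero_mul]

/-- Translation invariance of a sum of a `c`-periodic function over `ℤ^m / cℤ^m`. -/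
lemma sum_piFinset_range_add {c : ℕ} (hc : 0 < c) (F : (Fin m → ℤ) → ℂ)
    (hF : ∀ s v : Fin m → ℤ, F (s + c • v) = F s) (u : Fin m → ℤ) :
    ∑ r ∈ Fintype.piFinset (fun _ : Fin m => range c), F ((fun i => (r i : ℤ)) + u) =
      ∑ r ∈ Fintype.piFinset (fun _ : Fin m => range c), F (fun i => (r i : ℤ)) := by
  have hc' : (0 : ℤ) < c := by exact_mod_cast hc
  have hnn (a : ℤ) : 0 ≤ a % c := Int.emod_nonneg _ hc'.ne'
  have hlt (a : ℤ) : (a % c).toNat < c := by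
    have := Int.emod_lt_of_pos a hc'
    have := hnn a
    omega
  refine Finset.sum_nbij' (fun r i => (((r i : ℤ) + u i) % c).toNat)
    (fun r i => (((r i : ℤ) - u i) % c).toNat) ?_ ?_ ?_ ?_ ?_
  · intro r _
    simp [Fintype.mem_piFinset, hlt]
  · intro r _
    simp [Fintype.mem_piFinset, hlt]
  · intro r hr
    ext i
    have hri : r i < c := by simpa using (Fintype.mem_piFinset.mp hr) i
    simp only [Int.toNat_of_nonneg (hnn _), Int.emod_sub_emod, add_sub_cancel_right]
    rw [Int.emod_eq_of_lt (by positivity) (by exact_mod_cast hri), Int.toNat_natCast]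
  · intro r hr
    ext i
    have hri : r i < c := by simpa using (Fintype.mem_piFinset.mp hr) i
    simp only [Int.toNat_of_nonneg (hnn _), Int.emod_add_emod, sub_add_cancel]
    rw [Int.emod_eq_of_lt (by positivity) (by exact_mod_cast hri), Int.toNat_natCast]
  · intro r _
    rw [← hF (fun i => (((((r i : ℤ) + u i) % c).toNat : ℕ) : ℤ))
      (fun i => ((r i : ℤ) + u i) / c)]
    congr 1
    ext i
    simp only [Int.toNat_of_nonneg (hnn _), Pi.add_apply, nsmul_eq_mul]
    exact (Int.emod_add_mul_ediv _ _).symm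

lemma gaussSum_twist {N : ℕ} [NeZero N] {χ : DirichletCharacter ℂ N} (hχ : χ.IsPrimitive)
    (k : ℤ) :
    ∑ ν ∈ (range N).filter (fun ν => Nat.Coprime ν N),
        χ (ν : ZMod N) * eQ (((k * ν : ℤ) : ℚ) / N) =
      (starRingEnd ℂ) (χ (k : ZMod N)) * gaussS N χ := by
  have h1 : gaussS N χ = gaussSum χ ZMod.stdAddChar := by
    rw [gaussSum, ← sum_range_coprime_eq_sum_zmod, gaussS]
    refine Finset.sum_congr rfl fun u _ => ?_
    rw [← Int.cast_natCast (R := ℚ) u, eQ_intCast_div, Int.cast_natCast]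
  have h2 := gaussSum_mulShift_of_isPrimitive ZMod.stdAddChar hχ (k : ZMod N)
  rw [gaussSum, ← sum_range_coprime_eq_sum_zmod] at h2
  rw [h1, starRingEnd_apply, MulChar.star_apply', ← h2]
  refine Finset.sum_congr rfl fun ν _ => ?_
  rw [eQ_intCast_div, AddChar.mulShift_apply]
  push_cast
  rfl

/-- for `χ` primitive mod `N_β` and `gcd(c, N_β) = 1`, the sum
`G_{γ,n}(c; β, χ)` factors as `χ(c)χ̄(−N_β(γ,β))G(χ)` times a sum not involving `β`. -/
theorem Gsum_beta_dependence (m : ℕ) (hm : 1 ≤ m) (S : Matrix (Fin m) (Fin m) ℤ)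
    (hSsymm : S.IsSymm) (hSeven : ∀ i, 2 ∣ S i i) (hSdet : S.det ≠ 0)
    (γ : Fin m → ℚ) (hγ : memDual S γ) (n : ℚ) (hn : ∃ z : ℤ, n + Qf S γ = z)
    (β : Fin m → ℚ) (hβ : memDual S β) (hβiso : ∃ z : ℤ, Qf S β = z)
    (Nβ : ℕ) (hNβ : isOrderOf β Nβ)
    (χ : DirichletCharacter ℂ Nβ) (hχ : χ.IsPrimitive)
    (b : ℤ) (hb : (b : ℚ) = Nβ * bil S γ β)
    (c : ℕ) (hc : 0 < c) (hcop : Nat.Coprime c Nβ) :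
    Gsum S γ n β Nβ χ c =
      χ ((c : ℕ) : ZMod Nβ) * (starRingEnd ℂ) (χ ((-b : ℤ) : ZMod Nβ)) * gaussS Nβ χ *
        ∑ d ∈ (range c).filter (fun d => Nat.Coprime d c),
          ∑ r ∈ Fintype.piFinset (fun _ : Fin m => range c),
            eQ (((adInv c d : ℚ) * Qf S (fun i => (r i : ℚ))
                - bil S γ (fun i => (r i : ℚ))
                + (d : ℚ) * (Qf S γ + n)) / c) := by
  have : NeZero Nβ := ⟨hNβ.1.ne'⟩
  have hcQ : (c : ℚ) ≠ 0 := by exact_mod_cast hc.ne'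
  have hNQ : (Nβ : ℚ) ≠ 0 := by exact_mod_cast hNβ.1.ne'
  obtain ⟨N', t, hNt⟩ : ∃ N' t : ℤ, (Nβ : ℤ) * N' + c * t = 1 := by
    obtain ⟨a, b, h⟩ := (Nat.isCoprime_iff_coprime.mpr hcop.symm : IsCoprime (Nβ : ℤ) c)
    exact ⟨a, b, by linarith⟩
  have hNtQ : (Nβ : ℚ) * N' + c * t = 1 := by exact_mod_cast hNt
  choose w hw using hNβ.2.1
  obtain ⟨q, hq⟩ := hβiso
  have hinner (ν d : ℕ) :
      ∑ r ∈ Fintype.piFinset (fun _ : Fin m => range c),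
        eQ (((adInv c d : ℚ) * Qf S (ν • β + fun i => (r i : ℚ))
            - bil S γ (ν • β + fun i => (r i : ℚ))
            + (d : ℚ) * (Qf S γ + n)) / c) =
      eQ (((-b * t * ν : ℤ) : ℚ) / Nβ) *
      ∑ r ∈ Fintype.piFinset (fun _ : Fin m => range c),
        eQ (((adInv c d : ℚ) * Qf S (fun i => (r i : ℚ))
            - bil S γ (fun i => (r i : ℚ)) + (d : ℚ) * (Qf S γ + n)) / c) := by
    set F : (Fin m → ℤ) → ℂ := fun s =>
      eQ (((adInv c d : ℚ) * Qf S (fun i => (s i : ℚ))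
            - bil S γ (fun i => (s i : ℚ)) + (d : ℚ) * (Qf S γ + n)) / c) with hFdef
    have hF (s v : Fin m → ℤ) : F (s + c • v) = F s := by
      obtain ⟨z, hz⟩ := exists_Qf_intCast hSsymm hSeven v
      obtain ⟨y, hy⟩ := hγ v
      have hsv : (fun i => (((s + c • v) i : ℤ) : ℚ)) =
          (fun i => (s i : ℚ)) + (c : ℚ) • (fun i => (v i : ℚ)) := by
        ext i
        simp
      refine eQ_eq_of_sub_eq_intCast
        (adInv c d * (s ⬝ᵥ S.mulVec v + c * z) - y) ?_
      rw [hsv, Qf_add hSsymm, Qf_smul, bil_add_right, bil_smul_right, bil_smul_right,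
        bil_intCast, hz, hy]
      push_cast
      field_simp
      ring
    have hshift := sum_piFinset_range_add hc F hF (fun i => ν * N' * w i)
    simp only [hFdef, Int.cast_natCast] at hshift
    rw [← hshift, Finset.mul_sum]
    refine Finset.sum_congr rfl fun r _ => ?_
    set s : Fin m → ℤ := (fun i => (r i : ℤ)) + fun i => ν * N' * w i with hs
    obtain ⟨y, hy⟩ := hβ s
    have hvec : (ν • β + fun i => (r i : ℚ)) =
        ((c * t * ν : ℤ) : ℚ) • β + fun i => (s i : ℚ) := by
      ext i
      simp only [hs, Pi.add_apply, Pi.smul_apply, Pi.mul_apply, Pi.natCast_apply, nsmul_eq_mul,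
        smul_eq_mul]
      push_cast
      rw [← hw i]
      linear_combination (-(ν * β i : ℚ)) * hNtQ
    rw [← eQ_add]
    refine eQ_eq_of_sub_eq_intCast (adInv c d * (c * (t * ν) ^ 2 * q + t * ν * y)) ?_
    rw [hvec, Qf_add hSsymm, Qf_smul, bil_add_right, bil_smul_right, bil_smul_left, hq, hy]
    have hγβ : bil S γ β = b / Nβ := by rw [hb]; field_simp
    rw [hγβ]
    push_cast
    field_simp
    ring
  have hchar : (starRingEnd ℂ) (χ ((-b * t : ℤ) : ZMod Nβ)) =
      χ ((c : ℕ) : ZMod Nβ) * (starRingEnd ℂ) (χ ((-b : ℤ) : ZMod Nβ)) := by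
    have hct : (c : ZMod Nβ) * (t : ZMod Nβ) = 1 := by
      simpa using congrArg (Int.cast : ℤ → ZMod Nβ) hNt
    have h1 : χ (c : ZMod Nβ) * χ (t : ZMod Nβ) = 1 := by rw [← map_mul, hct, map_one]
    have h2 : (starRingEnd ℂ) (χ (t : ZMod Nβ)) = χ (c : ZMod Nβ) := by
      rw [starRingEnd_apply, MulChar.star_apply', ← mul_one (χ⁻¹ _), ← h1, mul_left_comm,
        ← MulChar.mul_apply, inv_mul_cancel, MulChar.one_apply (IsUnit.of_mul_eq_one_right _ hct),
        mul_one]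
    rw [Int.cast_mul, map_mul, map_mul, h2, mul_comm]
  rw [← hchar, ← gaussSum_twist hχ, Gsum, Finset.sum_mul]
  refine Finset.sum_congr rfl fun ν _ => ?_
  simp only [hinner, ← Finset.mul_sum, mul_assoc]

end EisensteinWeil
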